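/- Let λ : A_δ → ℝ be smooth and let ℓ ⊆ V(λ) be a closed line segment with distinct endpoints. Suppose p, q ∈ ℓ are points such that S_λ is constant on a relative neighborhood of p in ℓ and on a relative neighborhood of q in ℓ, with S_λ(p) ≠ S_λ(q), and suppose that for every x ∈ ℓ at which S_λ is locally constant along ℓ one has S_λ(x) = S_λ(p) or S_λ(x) = S_λ(q). Then S_λ(p) and S_λ(q) each have exactly 2 elements, and the set {x ∈ ℝ³ : S_λ(p) ∪ S_λ(q) ⊆ S_λ(x)} is a singleton {v} with v ∈ ℓ and card S_λ(v) = 4 (the two maximal cells meet in a vertex of the surface lying on ℓ). -/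

import Mathlib

open scoped BigOperators

noncomputable section

/-- Points of `ℝ³`. -/
abbrev V3 : Type := Fin 3 → ℝ

/-- The canonical embedding of a lattice point of `ℤ³` into `ℝ³`. -/
def zToR (a : Fin 3 → ℤ) : V3 := fun i => (a i : ℝ)

/-- The pairing `⟨a, x⟩ = ∑ aᵢ xᵢ` of a lattice point `a ∈ ℤ³` with `x ∈ ℝ³`. -/
def dotZR (a : Fin 3 → ℤ) (x : V3) : ℝ := ∑ i, (a i : ℝ) * x i

/-- The lattice points of `Γ_δ`:
`A_δ = {a ∈ ℤ³ : a₁,a₂,a₃ ≥ 0, a₁+a₂+a₃ ≤ δ}`. -/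
def Adelta (δ : ℕ) : Set (Fin 3 → ℤ) :=
  {a | (∀ i, 0 ≤ a i) ∧ a 0 + a 1 + a 2 ≤ (δ : ℤ)}

/-- The argmax set `S_λ(x) = {a ∈ A_δ : λ(a) + ⟨a,x⟩ = max_{b ∈ A_δ} (λ(b) + ⟨b,x⟩)}`. -/
def Sarg (δ : ℕ) (lam : (Fin 3 → ℤ) → ℝ) (x : V3) : Set (Fin 3 → ℤ) :=
  {a | a ∈ Adelta δ ∧ ∀ b ∈ Adelta δ, lam b + dotZR b x ≤ lam a + dotZR a x}

/-- The tropical surface `V(λ) = {x ∈ ℝ³ : S_λ(x) has at least 2 elements}`. -/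
def Vtrop (δ : ℕ) (lam : (Fin 3 → ℤ) → ℝ) : Set V3 :=
  {x | ∃ a ∈ Sarg δ lam x, ∃ b ∈ Sarg δ lam x, a ≠ b}

/-- The determinant of the `3×3` integer matrix with rows `u, v, w`. -/
def detZ (u v w : Fin 3 → ℤ) : ℤ := Matrix.det (Matrix.of ![u, v, w])

/-- `λ` is smooth (tropically): for every `x ∈ ℝ³` the set `S_λ(x)` is affinely independent in `ℝ³`,
and whenever `S_λ(x)` has exactly 4 elements `a₀,a₁,a₂,a₃`, the tetrahedron they span is
unimodular: `|det(a₁−a₀, a₂−a₀, a₃−a₀)| = 1`. -/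
def TropSmooth (δ : ℕ) (lam : (Fin 3 → ℤ) → ℝ) : Prop :=
  ∀ x : V3,
    AffineIndependent ℝ (fun a : Sarg δ lam x => zToR a.1) ∧
    ∀ a₀ a₁ a₂ a₃ : Fin 3 → ℤ,
      Sarg δ lam x = {a₀, a₁, a₂, a₃} → (Sarg δ lam x).ncard = 4 →
      |detZ (a₁ - a₀) (a₂ - a₀) (a₃ - a₀)| = 1

/-- The four directions `ω₁ = −e₁`, `ω₂ = −e₂`, `ω₃ = −e₃`, `ω₄ = e₁+e₂+e₃`. -/
def ωdir : Fin 4 → V3 := ![![-1, 0, 0], ![0, -1, 0], ![0, 0, -1], ![1, 1, 1]]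

/-- The closed ray from `p` in direction `d`. -/
def ray (p d : V3) : Set V3 := {x | ∃ t : ℝ, 0 ≤ t ∧ x = p + t • d}

/-- The tropical line with vertices `v, w`, rays in directions `ω_i, ω_j` at `v` and
`ω_k, ω_l` at `w`. -/
def TLine (v w : V3) (i j k l : Fin 4) : Set V3 :=
  ray v (ωdir i) ∪ ray v (ωdir j) ∪ segment ℝ v w ∪ ray w (ωdir k) ∪ ray w (ωdir l)

/-- The data `(v, w, i, j, k, l)` describes a genuine tropical line: `{i,j,k,l} = {1,2,3,4}`
and `w = v + t·(ω_k + ω_l)` for some `t ≥ 0`. -/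
def IsTLineData (v w : V3) (i j k l : Fin 4) : Prop :=
  ({i, j, k, l} : Finset (Fin 4)) = Finset.univ ∧
  ∃ t : ℝ, 0 ≤ t ∧ w = v + t • (ωdir k + ωdir l)

/-- A subset `L ⊆ ℝ³` is a tropical line. -/
def IsTropicalLine (L : Set V3) : Prop :=
  ∃ v w i j k l, IsTLineData v w i j k l ∧ L = TLine v w i j k l

/-- `S_λ` is constant on a relative neighborhood of `z` in `s`. -/
def LocConstAlong (δ : ℕ) (lam : (Fin 3 → ℤ) → ℝ) (s : Set V3) (z : V3) : Prop :=
  ∃ ε : ℝ, 0 < ε ∧ ∀ z' ∈ s, dist z' z < ε → Sarg δ lam z' = Sarg δ lam z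

/-- The affine function attached to a lattice point. -/
def gfun (lam : (Fin 3 → ℤ) → ℝ) (a : Fin 3 → ℤ) (z : V3) : ℝ := lam a + dotZR a z

/-- Parametrization of the segment. -/
def pt (x y : V3) (t : ℝ) : V3 := (1 - t) • x + t • y

lemma mem_seg_iff (x y z : V3) : z ∈ segment ℝ x y ↔ ∃ t : ℝ, 0 ≤ t ∧ t ≤ 1 ∧ z = pt x y t := by
  rw [segment_eq_image]
  constructor
  · rintro ⟨t, ht, rfl⟩
    exact ⟨t, ht.1, ht.2, rfl⟩
  · rintro ⟨t, h0, h1, rfl⟩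
    exact ⟨t, ⟨h0, h1⟩, rfl⟩

lemma gfun_pt (lam : (Fin 3 → ℤ) → ℝ) (a : Fin 3 → ℤ) (x y : V3) (t : ℝ) :
    gfun lam a (pt x y t) = (1 - t) * gfun lam a x + t * gfun lam a y := by
  simp only [gfun, pt, dotZR, Fin.sum_univ_three, Pi.add_apply, Pi.smul_apply, smul_eq_mul]
  ring

lemma continuous_gfun (lam : (Fin 3 → ℤ) → ℝ) (a : Fin 3 → ℤ) : Continuous (gfun lam a) := by
  unfold gfun dotZR
  fun_prop

lemma continuous_pt (x y : V3) : Continuous (pt x y) := by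
  unfold pt
  fun_prop

lemma Adelta_finite (δ : ℕ) : (Adelta δ).Finite := by
  refine (Set.finite_Icc (0 : Fin 3 → ℤ) (fun _ => (δ : ℤ))).subset ?_
  rintro a ⟨h0, h1⟩
  refine ⟨fun i => h0 i, fun i => ?_⟩
  have := h0 0
  have := h0 1
  have := h0 2
  fin_cases i <;> simp <;> omega

lemma mem_Sarg (δ : ℕ) (lam : (Fin 3 → ℤ) → ℝ) (z : V3) (a : Fin 3 → ℤ) :
    a ∈ Sarg δ lam z ↔ a ∈ Adelta δ ∧ ∀ b ∈ Adelta δ, gfun lam b z ≤ gfun lam a z := Iff.rfl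

lemma Sarg_eq_val {δ : ℕ} {lam : (Fin 3 → ℤ) → ℝ} {z : V3} {a b : Fin 3 → ℤ}
    (ha : a ∈ Sarg δ lam z) (hb : b ∈ Sarg δ lam z) : gfun lam a z = gfun lam b z :=
  le_antisymm (hb.2 a ha.1) (ha.2 b hb.1)

lemma mem_Sarg_of_eq {δ : ℕ} {lam : (Fin 3 → ℤ) → ℝ} {z : V3} {a b : Fin 3 → ℤ}
    (ha : a ∈ Sarg δ lam z) (hb : b ∈ Adelta δ) (h : gfun lam a z = gfun lam b z) :
    b ∈ Sarg δ lam z := by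
  rw [mem_Sarg] at ha ⊢
  exact ⟨hb, fun c hc => h ▸ ha.2 c hc⟩

/-- Points of the parameter interval near a given parameter form an infinite set. -/
lemma infinite_near (t ε : ℝ) (h0 : 0 ≤ t) (h1 : t ≤ 1) (hε : 0 < ε) :
    {s : ℝ | 0 ≤ s ∧ s ≤ 1 ∧ dist s t < ε}.Infinite := by
  have h : max 0 (t - ε) < min 1 (t + ε) := by
    rw [max_lt_iff, lt_min_iff, lt_min_iff]
    refine ⟨⟨?_, ?_⟩, ?_, ?_⟩ <;> linarith
  refine (Set.Ioo_infinite h).mono ?_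
  rintro s ⟨hs1, hs2⟩
  rw [max_lt_iff] at hs1
  rw [lt_min_iff] at hs2
  refine ⟨hs1.1.le, hs2.1.le, ?_⟩
  rw [Real.dist_eq, abs_lt]
  constructor <;> linarith [hs1.2, hs2.2]

/-- Two affine functions agreeing at two parameters agree everywhere. -/
lemma affine_eq {A B C D s t : ℝ} (hst : s ≠ t)
    (h1 : (1 - s) * A + s * B = (1 - s) * C + s * D)
    (h2 : (1 - t) * A + t * B = (1 - t) * C + t * D) : A = C ∧ B = D := by
  have hne : s - t ≠ 0 := sub_ne_zero.2 hst
  constructor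
  · have : (s - t) * (A - C) = 0 := by linear_combination s * h2 - t * h1
    have := (mul_eq_zero.1 this).resolve_left hne
    linarith
  · have : (s - t) * (B - D) = 0 := by linear_combination (1 - t) * h1 - (1 - s) * h2
    have := (mul_eq_zero.1 this).resolve_left hne
    linarith

/-- If `S` is locally constant along the segment at `p`, the functions in `S p` agree on the
whole segment. -/
lemma locConst_agree {δ : ℕ} {lam : (Fin 3 → ℤ) → ℝ} {x y p : V3}
    (hp : p ∈ segment ℝ x y) (hl : LocConstAlong δ lam (segment ℝ x y) p)
    {a b : Fin 3 → ℤ} (ha : a ∈ Sarg δ lam p) (hb : b ∈ Sarg δ lam p) :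
    ∀ z ∈ segment ℝ x y, gfun lam a z = gfun lam b z := by
  obtain ⟨t, h0, h1, rfl⟩ := (mem_seg_iff x y p).1 hp
  obtain ⟨ε, hε, hS⟩ := hl
  obtain ⟨η, hη, hc⟩ := Metric.continuous_iff.1 (continuous_pt x y) t ε hε
  obtain ⟨s, ⟨hs0, hs1, hs⟩, hst⟩ :=
    ((infinite_near t η h0 h1 hη).sdiff (Set.finite_singleton t)).nonempty
  have hSs := hS (pt x y s) ((mem_seg_iff _ _ _).2 ⟨s, hs0, hs1, rfl⟩) (hc s hs)
  have e1 := Sarg_eq_val ha hb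
  have e2 := Sarg_eq_val (hSs ▸ ha) (hSs ▸ hb)
  rw [gfun_pt, gfun_pt] at e1 e2
  obtain ⟨hA, hB⟩ := affine_eq (fun h => hst (by simp [h])) e2 e1
  intro z hz
  obtain ⟨u, -, -, rfl⟩ := (mem_seg_iff x y z).1 hz
  rw [gfun_pt, gfun_pt, hA, hB]

/-- Near any point of the segment there is one where `S` is locally constant. -/
lemma exists_locConst (δ : ℕ) (lam : (Fin 3 → ℤ) → ℝ) (x y v : V3)
    (hv : v ∈ segment ℝ x y) (ε : ℝ) (hε : 0 < ε) :
    ∃ z ∈ segment ℝ x y, dist z v < ε ∧ LocConstAlong δ lam (segment ℝ x y) z := by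
  obtain ⟨t, h0, h1, rfl⟩ := (mem_seg_iff x y v).1 hv
  obtain ⟨η, hη, hc⟩ := Metric.continuous_iff.1 (continuous_pt x y) t ε hε
  have hbad : (⋃ c ∈ Adelta δ, ⋃ d ∈ Adelta δ, {s : ℝ | gfun lam c (pt x y s) =
      gfun lam d (pt x y s) ∧ ¬ (gfun lam c x = gfun lam d x ∧
        gfun lam c y = gfun lam d y)}).Finite := by
    refine (Adelta_finite δ).biUnion fun c _ => (Adelta_finite δ).biUnion fun d _ => ?_
    refine Set.Subsingleton.finite ?_
    rintro s ⟨hs, hn⟩ u ⟨hu, -⟩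
    by_contra hne
    rw [gfun_pt, gfun_pt] at hs hu
    exact hn (affine_eq hne hs hu)
  obtain ⟨s, ⟨hs0, hs1, hs⟩, hsb⟩ := ((infinite_near t η h0 h1 hη).sdiff hbad).nonempty
  refine ⟨pt x y s, (mem_seg_iff _ _ _).2 ⟨s, hs0, hs1, rfl⟩, hc s hs, ?_⟩
  have hagree : ∀ c ∈ Adelta δ, ∀ d ∈ Adelta δ,
      gfun lam c (pt x y s) = gfun lam d (pt x y s) →
      ∀ z ∈ segment ℝ x y, gfun lam c z = gfun lam d z := by
    intro c hc d hd he z hz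
    obtain ⟨u, -, -, rfl⟩ := (mem_seg_iff x y z).1 hz
    by_contra hne
    refine hsb ?_
    simp only [Set.mem_iUnion]
    refine ⟨c, hc, d, hd, he, fun h => hne ?_⟩
    rw [gfun_pt, gfun_pt, h.1, h.2]
  have hev : ∀ᶠ z in nhds (pt x y s), ∀ c ∈ Adelta δ, ∀ d ∈ Adelta δ,
      gfun lam c (pt x y s) < gfun lam d (pt x y s) → gfun lam c z < gfun lam d z := by
    rw [Filter.eventually_all_finite (Adelta_finite δ)]
    intro c _
    rw [Filter.eventually_all_finite (Adelta_finite δ)]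
    intro d _
    by_cases h : gfun lam c (pt x y s) < gfun lam d (pt x y s)
    · filter_upwards [(isOpen_lt (continuous_gfun lam c) (continuous_gfun lam d)).mem_nhds h]
        with z hz _ using hz
    · exact Filter.Eventually.of_forall fun z h' => absurd h' h
  obtain ⟨r, hr, hball⟩ := Metric.eventually_nhds_iff.1 hev
  refine ⟨r, hr, fun z hz hzd => ?_⟩
  have hlt := hball hzd
  ext a
  rw [mem_Sarg, mem_Sarg]
  refine and_congr_right fun ha => forall₂_congr fun b hb => ?_
  rcases lt_trichotomy (gfun lam a (pt x y s)) (gfun lam b (pt x y s)) with h | h | h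
  · have := hlt a ha b hb h
    constructor <;> intro <;> linarith
  · have := hagree a ha b hb h z hz
    constructor <;> intro <;> linarith
  · have := hlt b hb a ha h
    constructor <;> intro <;> linarith

lemma Sarg_finite (δ : ℕ) (lam : (Fin 3 → ℤ) → ℝ) (z : V3) : (Sarg δ lam z).Finite :=
  (Adelta_finite δ).subset fun _ h => h.1

lemma Sarg_ncard_le {δ : ℕ} {lam : (Fin 3 → ℤ) → ℝ} (hsm : TropSmooth δ lam) (z : V3) :
    (Sarg δ lam z).ncard ≤ 4 := by
  have := (Sarg_finite δ lam z).fintype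
  have h := (hsm z).1.card_le_finrank_succ
  have h2 := Submodule.finrank_le
    (vectorSpan ℝ (Set.range fun a : Sarg δ lam z => zToR a.1))
  rw [Module.finrank_fin_fun] at h2
  rw [← Nat.card_coe_set_eq, Nat.card_eq_fintype_card]
  omega

lemma Sarg_vertex_unique {δ : ℕ} {lam : (Fin 3 → ℤ) → ℝ} (hsm : TropSmooth δ lam) (v z : V3)
    (hv : (Sarg δ lam v).ncard = 4) (hz : Sarg δ lam v ⊆ Sarg δ lam z) : z = v := by
  have := (Sarg_finite δ lam v).fintype
  have htop := (hsm v).1.vectorSpan_eq_top_of_card_eq_finrank_add_one (by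
    rw [Module.finrank_fin_fun, ← Nat.card_eq_fintype_card, Nat.card_coe_set_eq, hv])
  let φ : V3 →ₗ[ℝ] ℝ := ∑ i, (z - v) i • LinearMap.proj i
  have hφ : ∀ w, φ w = ∑ i, (z - v) i * w i := by
    intro w
    simp [φ]
  have hle : vectorSpan ℝ (Set.range fun a : Sarg δ lam v => zToR a.1) ≤ LinearMap.ker φ := by
    rw [vectorSpan_def, Submodule.span_le]
    rintro w ⟨_, ⟨⟨a, ha⟩, rfl⟩, _, ⟨⟨b, hb⟩, rfl⟩, rfl⟩
    have e1 := Sarg_eq_val ha hb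
    have e2 := Sarg_eq_val (hz ha) (hz hb)
    simp only [gfun, dotZR, Fin.sum_univ_three] at e1 e2
    simp only [SetLike.mem_coe, LinearMap.mem_ker, hφ, Fin.sum_univ_three, vsub_eq_sub,
      Pi.sub_apply, zToR]
    linear_combination e2 - e1
  rw [htop] at hle
  have h0 : φ (z - v) = 0 := hle (Submodule.mem_top)
  rw [hφ] at h0
  have h1 := (Finset.sum_eq_zero_iff_of_nonneg (fun i _ => mul_self_nonneg _)).1 h0
  ext i
  have := mul_self_eq_zero.1 (h1 i (Finset.mem_univ i))
  simpa [sub_eq_zero] using this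

/-- An affine function with a sign change between two points of a segment vanishes on it. -/
lemma exists_cross (lam : (Fin 3 → ℤ) → ℝ) (a b : Fin 3 → ℤ) (p q : V3)
    (hp : gfun lam b p ≤ gfun lam a p) (hq : gfun lam a q ≤ gfun lam b q) :
    ∃ v ∈ segment ℝ p q, gfun lam a v = gfun lam b v := by
  obtain ⟨v, hv, h⟩ := (convex_segment p q).isPreconnected.intermediate_value₂
    (left_mem_segment ℝ p q) (right_mem_segment ℝ p q)
    (continuous_gfun lam b).continuousOn (continuous_gfun lam a).continuousOn hp hq
  exact ⟨v, hv, h.symm⟩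

/-- If a segment contained in a smooth tropical surface trespasses exactly two cells,
then both cells are maximal (`card = 2` dually) and they meet in a single vertex of the
surface, which lies on the segment. -/
theorem trespassing_segment_meets_vertex (δ : ℕ) (lam : (Fin 3 → ℤ) → ℝ)
    (hsm : TropSmooth δ lam) (x y : V3) (hxy : x ≠ y)
    (hsub : segment ℝ x y ⊆ Vtrop δ lam)
    (p q : V3) (hp : p ∈ segment ℝ x y) (hq : q ∈ segment ℝ x y)
    (hlp : LocConstAlong δ lam (segment ℝ x y) p)
    (hlq : LocConstAlong δ lam (segment ℝ x y) q)
    (hpq : Sarg δ lam p ≠ Sarg δ lam q)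
    (honly : ∀ z ∈ segment ℝ x y, LocConstAlong δ lam (segment ℝ x y) z →
      Sarg δ lam z = Sarg δ lam p ∨ Sarg δ lam z = Sarg δ lam q) :
    (Sarg δ lam p).ncard = 2 ∧ (Sarg δ lam q).ncard = 2 ∧
    ∃ v : V3, {z : V3 | Sarg δ lam p ∪ Sarg δ lam q ⊆ Sarg δ lam z} = {v} ∧
      v ∈ segment ℝ x y ∧ (Sarg δ lam v).ncard = 4 := by
  obtain ⟨a, ha, a', ha', haa⟩ := hsub hp
  obtain ⟨b, hb, b', hb', hbb⟩ := hsub hq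
  obtain ⟨v, hvpq, hveq⟩ := exists_cross lam a b p q (ha.2 b hb.1) (hb.2 a ha.1)
  have hv : v ∈ segment ℝ x y := (convex_segment x y).segment_subset hp hq hvpq
  have hmax : ∀ c ∈ Adelta δ, gfun lam c v ≤ gfun lam a v := by
    intro c hc
    by_contra! hlt
    have hopen : {z | gfun lam a z < gfun lam c z} ∩ {z | gfun lam b z < gfun lam c z} ∈ nhds v :=
      Filter.inter_mem
        ((isOpen_lt (continuous_gfun lam a) (continuous_gfun lam c)).mem_nhds hlt)
        ((isOpen_lt (continuous_gfun lam b) (continuous_gfun lam c)).mem_nhds (show gfun lam b v < gfun lam c v from hveq.symm.trans_lt hlt))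
    obtain ⟨ε, hε, hball⟩ := Metric.mem_nhds_iff.1 hopen
    obtain ⟨z, hz, hzd, hlz⟩ := exists_locConst δ lam x y v hv ε hε
    obtain ⟨h1, h2⟩ := hball hzd
    rcases honly z hz hlz with h | h
    · have : a ∈ Sarg δ lam z := h ▸ ha
      exact absurd (this.2 c hc) (not_le.2 h1)
    · have : b ∈ Sarg δ lam z := h ▸ hb
      exact absurd (this.2 c hc) (not_le.2 h2)
  have hav : a ∈ Sarg δ lam v := ⟨ha.1, hmax⟩
  have hbv : b ∈ Sarg δ lam v := mem_Sarg_of_eq hav hb.1 hveq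
  have hPv : Sarg δ lam p ⊆ Sarg δ lam v := fun c hc =>
    mem_Sarg_of_eq hav hc.1 (locConst_agree hp hlp ha hc v hv)
  have hQv : Sarg δ lam q ⊆ Sarg δ lam v := fun c hc =>
    mem_Sarg_of_eq hbv hc.1 (locConst_agree hq hlq hb hc v hv)
  have hdisj : Disjoint (Sarg δ lam p) (Sarg δ lam q) := by
    rw [Set.disjoint_left]
    intro c hcp hcq
    apply hpq
    ext d
    constructor
    · intro hd
      exact mem_Sarg_of_eq hcq hd.1 (locConst_agree hp hlp hcp hd q hq)
    · intro hd
      exact mem_Sarg_of_eq hcp hd.1 (locConst_agree hq hlq hcq hd p hp)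
  have hsubv : Sarg δ lam p ∪ Sarg δ lam q ⊆ Sarg δ lam v := Set.union_subset hPv hQv
  have hcard := Set.ncard_union_eq hdisj (Sarg_finite δ lam p) (Sarg_finite δ lam q)
  have hcle := Set.ncard_le_ncard hsubv (Sarg_finite δ lam v)
  have h4 := Sarg_ncard_le hsm v
  have hP2 : 1 < (Sarg δ lam p).ncard :=
    (Set.one_lt_ncard (Sarg_finite δ lam p)).2 ⟨a, ha, a', ha', haa⟩
  have hQ2 : 1 < (Sarg δ lam q).ncard :=
    (Set.one_lt_ncard (Sarg_finite δ lam q)).2 ⟨b, hb, b', hb', hbb⟩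
  have hv4 : (Sarg δ lam v).ncard = 4 := by omega
  have heq : Sarg δ lam p ∪ Sarg δ lam q = Sarg δ lam v :=
    Set.eq_of_subset_of_ncard_le hsubv (by omega) (Sarg_finite δ lam v)
  refine ⟨by omega, by omega, v, ?_, hv, hv4⟩
  ext z
  rw [heq]
  constructor
  · intro hz
    exact Sarg_vertex_unique hsm v z hv4 hz
  · rintro rfl
    exact fun c hc => hc
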